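/- For all A, B ∈ 𝒜 = Ã₁ ∩ Ã₂, the doubly contracted tensor product A : B is well defined (all the defining series converge absolutely), belongs to 𝒜, and satisfies ‖A : B‖_𝒜 ≤ ‖A‖_𝒜 ‖B‖_𝒜. -/

import Mathlib

open scoped ComplexConjugate

noncomputable section

namespace PaperTensor

variable {I I₁ I₂ : Type*}

/-- The space `ℓ²(I)`. -/
abbrev L2 (I : Type*) := lp (fun _ : I => ℂ) 2

/-- The continuous linear map `T` represents the matrix `M` as an operator on `ℓ²(I)`,
i.e. `(T c) k = Σ_l M k l * c l` for every `c ∈ ℓ²(I)`. -/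
def Represents (M : I → I → ℂ) (T : L2 I →L[ℂ] L2 I) : Prop :=
  ∀ c : L2 I, ∀ k : I, HasSum (fun l : I => M k l * (c : ∀ _ : I, ℂ) l) ((T c : ∀ _ : I, ℂ) k)

/-- `M` defines a bounded operator on `ℓ²(I)`. -/
def Bounded2 (M : I → I → ℂ) : Prop := ∃ T : L2 I →L[ℂ] L2 I, Represents M T

/-- The operator norm `‖M‖_{B(ℓ²(I))}` of the matrix `M` (junk value `0` if `M` is unbounded). -/
noncomputable def opNorm2 (M : I → I → ℂ) : ℝ :=
  letI : Decidable (Bounded2 M) := Classical.propDecidable _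
  if h : Bounded2 M then ‖h.choose‖ else 0

/-- The matrix product of two infinite matrices. -/
noncomputable def matMul (A B : I → I → ℂ) : I → I → ℂ :=
  fun i j => ∑' m : I, A i m * B m j

/-- The conjugate transpose of a matrix. -/
def conjTranspose (A : I → I → ℂ) : I → I → ℂ := fun i j => conj (A j i)

/-- A solid Banach algebra of (infinite) matrices over the index set `I`. -/
structure SolidBanachAlgebra (I : Type*) where
  carrier : Set (I → I → ℂ)
  anorm : (I → I → ℂ) → ℝ
  zero_mem : (0 : I → I → ℂ) ∈ carrier
  add_mem : ∀ A B : I → I → ℂ, A ∈ carrier → B ∈ carrier → A + B ∈ carrier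
  smul_mem : ∀ (c : ℂ) (A : I → I → ℂ), A ∈ carrier → c • A ∈ carrier
  mul_mem : ∀ A B : I → I → ℂ, A ∈ carrier → B ∈ carrier → matMul A B ∈ carrier
  anorm_nonneg : ∀ A ∈ carrier, 0 ≤ anorm A
  anorm_zero : anorm 0 = 0
  anorm_eq_zero : ∀ A ∈ carrier, anorm A = 0 → A = 0
  anorm_smul : ∀ (c : ℂ), ∀ A ∈ carrier, anorm (c • A) = ‖c‖ * anorm A
  anorm_add : ∀ A ∈ carrier, ∀ B ∈ carrier, anorm (A + B) ≤ anorm A + anorm B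
  anorm_mul : ∀ A ∈ carrier, ∀ B ∈ carrier, anorm (matMul A B) ≤ anorm A * anorm B
  complete : ∀ f : ℕ → (I → I → ℂ), (∀ n, f n ∈ carrier) →
      (∀ ε > (0 : ℝ), ∃ N : ℕ, ∀ m ≥ N, ∀ n ≥ N, anorm (f m - f n) < ε) →
      ∃ A ∈ carrier, ∀ ε > (0 : ℝ), ∃ N : ℕ, ∀ n ≥ N, anorm (f n - A) < ε
  bounded : ∀ A ∈ carrier, Bounded2 A
  solid : ∀ A ∈ carrier, ∀ B : I → I → ℂ,
      (∀ i j, ‖B i j‖ ≤ ‖A i j‖) → B ∈ carrier ∧ anorm B ≤ anorm A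

/-- A matrix algebra is involutive if it is closed under conjugate transposition and the
norm is invariant under it. -/
def SolidBanachAlgebra.Involutive (𝒜 : SolidBanachAlgebra I) : Prop :=
  ∀ A ∈ 𝒜.carrier, conjTranspose A ∈ 𝒜.carrier ∧ 𝒜.anorm (conjTranspose A) = 𝒜.anorm A

/-- Rank-four tensors `(A_{i,k,l,j})` indexed by `I₁ × I₂² × I₁`. -/
abbrev Tensor (I₁ I₂ : Type*) := I₁ → I₂ → I₂ → I₁ → ℂ

/-- The restriction `A|_{{i} × I₂² × {j}}`, an `I₂ × I₂` matrix. -/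
def res1 (A : Tensor I₁ I₂) (i j : I₁) : I₂ → I₂ → ℂ := fun k l => A i k l j

/-- The restriction `A|_{I₁ × {(k,l)} × I₁}`, an `I₁ × I₁` matrix. -/
def res2 (A : Tensor I₁ I₂) (k l : I₂) : I₁ → I₁ → ℂ := fun i j => A i k l j

/-- Membership in `Ã₁`, for a set `S` of `I₁ × I₁` matrices playing the role of `𝒜₁`:
all restrictions `A|_{{i} × I₂² × {j}}` are bounded on `ℓ²(I₂)` and the matrix of their
operator norms belongs to `S`. -/
def MemT1 (S : Set (I₁ → I₁ → ℂ)) (A : Tensor I₁ I₂) : Prop :=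
  (∀ i j : I₁, Bounded2 (res1 A i j)) ∧
    (fun i j : I₁ => (opNorm2 (res1 A i j) : ℂ)) ∈ S

/-- Membership in `Ã₂`. -/
def MemT2 (S : Set (I₂ → I₂ → ℂ)) (A : Tensor I₁ I₂) : Prop :=
  (∀ k l : I₂, Bounded2 (res2 A k l)) ∧
    (fun k l : I₂ => (opNorm2 (res2 A k l) : ℂ)) ∈ S

/-- The norm `‖A‖_{Ã₁}` (meaningful on members of `Ã₁`). -/
noncomputable def normT1 (𝒜₁ : SolidBanachAlgebra I₁) (A : Tensor I₁ I₂) : ℝ :=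
  𝒜₁.anorm (fun i j : I₁ => (opNorm2 (res1 A i j) : ℂ))

/-- The norm `‖A‖_{Ã₂}` (meaningful on members of `Ã₂`). -/
noncomputable def normT2 (𝒜₂ : SolidBanachAlgebra I₂) (A : Tensor I₁ I₂) : ℝ :=
  𝒜₂.anorm (fun k l : I₂ => (opNorm2 (res2 A k l) : ℂ))

/-- Membership in `𝒜 = Ã₁ ∩ Ã₂`. -/
def MemA (𝒜₁ : SolidBanachAlgebra I₁) (𝒜₂ : SolidBanachAlgebra I₂) (A : Tensor I₁ I₂) : Prop :=
  MemT1 𝒜₁.carrier A ∧ MemT2 𝒜₂.carrier A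

/-- The norm `‖A‖_𝒜 = max {‖A‖_{Ã₁}, ‖A‖_{Ã₂}}`. -/
noncomputable def normA (𝒜₁ : SolidBanachAlgebra I₁) (𝒜₂ : SolidBanachAlgebra I₂)
    (A : Tensor I₁ I₂) : ℝ :=
  max (normT1 𝒜₁ A) (normT2 𝒜₂ A)

/-- The matrix over `I₁ × I₂` through which a rank-four tensor acts on `ℓ²(I₁ × I₂)`:
`(Ac)_{(i,k)} = Σ_{(m,n)} A_{i,k,n,m} c_{(m,n)}`. -/
def toMatrix (A : Tensor I₁ I₂) : (I₁ × I₂) → (I₁ × I₂) → ℂ :=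
  fun p q => A p.1 p.2 q.2 q.1

/-- The rank-four tensor of matrix entries of an operator `T` on `ℓ²(I₁ × I₂)`:
its `(i,k,l,j)` entry is the `((i,k),(j,l))` matrix entry of `T`. -/
noncomputable def entryTensor (T : L2 (I₁ × I₂) →L[ℂ] L2 (I₁ × I₂)) : Tensor I₁ I₂ :=
  letI : DecidableEq (I₁ × I₂) := Classical.decEq _
  fun i k l j => (T (lp.single 2 (j, l) (1 : ℂ)) : ∀ _ : I₁ × I₂, ℂ) (i, k)

/-- A set `S` of rank-four tensors is inverse-closed if, whenever `A ∈ S` acts as a boundedly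
invertible operator on `ℓ²(I₁ × I₂)`, the rank-four tensor of matrix entries of the inverse
operator also belongs to `S`. -/
def InverseClosed (S : Set (Tensor I₁ I₂)) : Prop :=
  ∀ A ∈ S, ∀ T Tinv : L2 (I₁ × I₂) →L[ℂ] L2 (I₁ × I₂),
    Represents (toMatrix A) T →
    T.comp Tinv = ContinuousLinearMap.id ℂ (L2 (I₁ × I₂)) →
    Tinv.comp T = ContinuousLinearMap.id ℂ (L2 (I₁ × I₂)) →
    entryTensor Tinv ∈ S

/-- The doubly contracted tensor product
`(A : B)_{i,k,l,j} = Σ_{n ∈ I₂} Σ_{m ∈ I₁} A_{i,k,n,m} B_{m,n,l,j}`. -/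
noncomputable def contract (A B : Tensor I₁ I₂) : Tensor I₁ I₂ :=
  fun i k l j => ∑' n : I₂, ∑' m : I₁, A i k n m * B m n l j

/-- Absolute convergence of all series defining the doubly contracted tensor product. -/
def ContractSummable (A B : Tensor I₁ I₂) : Prop :=
  ∀ (i : I₁) (k l : I₂) (j : I₁),
    Summable (fun nm : I₂ × I₁ => ‖A i k nm.1 nm.2 * B nm.2 nm.1 l j‖)

/-- The adjoint tensor `(A*)_{i,k,l,j} = conj (A_{j,l,k,i})`. -/
def adjT (A : Tensor I₁ I₂) : Tensor I₁ I₂ := fun i k l j => conj (A j l k i)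


open Classical in
theorem represents_iff {M : I → I → ℂ} {T : L2 I →L[ℂ] L2 I} :
    Represents M T ↔ ∀ k l, (T (lp.single 2 l (1 : ℂ)) : ∀ _ : I, ℂ) k = M k l := by
  constructor
  · intro h k l
    refine (h (lp.single 2 l (1 : ℂ)) k).unique ?_
    convert hasSum_single (f := fun n : I => M k n * (lp.single 2 l (1 : ℂ) : L2 I) n) l ?_ using 1
    · simp
    · intro n hn
      simp [hn]
  · intro h c k
    have hc := lp.hasSum_single (E := fun _ : I => ℂ) (p := 2) (by norm_num) c
    have hT := (hc.mapL T).mapL (lp.evalCLM ℂ (fun _ : I => ℂ) 2 k)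
    refine (congrArg (HasSum · ((T c : ∀ _ : I, ℂ) k)) (funext fun l => ?_)).mpr hT
    have hs : (lp.single 2 l (c l) : L2 I) = c l • lp.single 2 l (1 : ℂ) := by
      rw [← lp.single_smul]; simp
    rw [hs, map_smul, map_smul, ← h k l, smul_eq_mul, mul_comm]
    rfl

theorem Represents.opNorm2_eq {M : I → I → ℂ} {T : L2 I →L[ℂ] L2 I} (h : Represents M T) :
    opNorm2 M = ‖T‖ := by
  have hb : Bounded2 M := ⟨T, h⟩
  rw [opNorm2, dif_pos hb]
  congr 1
  ext c k
  exact (hb.choose_spec c k).unique (h c k)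

theorem opNorm2_nonneg (M : I → I → ℂ) : 0 ≤ opNorm2 M := by
  rw [opNorm2]
  split_ifs
  exacts [norm_nonneg _, le_rfl]

theorem Bounded2.exists_represents {M : I → I → ℂ} (h : Bounded2 M) :
    ∃ T : L2 I →L[ℂ] L2 I, Represents M T ∧ ‖T‖ = opNorm2 M :=
  h.imp fun _ hT => ⟨hT, hT.opNorm2_eq.symm⟩

/-- Rows of a bounded matrix are square summable, with norm at most the operator norm. -/
theorem Represents.exists_row {M : I → I → ℂ} {T : L2 I →L[ℂ] L2 I} (h : Represents M T) (k : I) :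
    ∃ f : L2 I, ‖f‖ ≤ ‖T‖ ∧ ∀ n, ‖f n‖ = ‖M k n‖ := by
  classical
  refine ⟨ContinuousLinearMap.adjoint T (lp.single 2 k (1 : ℂ)), ?_, fun n => ?_⟩
  · refine (ContinuousLinearMap.le_opNorm _ _).trans ?_
    rw [LinearIsometryEquiv.norm_map, lp.norm_single (by norm_num)]
    simp
  · rw [← represents_iff.1 h k n]
    have h₁ := ContinuousLinearMap.adjoint_inner_right T
      (lp.single 2 n (1 : ℂ) : L2 I) (lp.single 2 k (1 : ℂ))
    rw [lp.inner_single_left, lp.inner_single_right] at h₁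
    simpa using congrArg norm h₁

/-- Columns of a bounded matrix are square summable, with norm at most the operator norm. -/
theorem Represents.exists_col {M : I → I → ℂ} {T : L2 I →L[ℂ] L2 I} (h : Represents M T) (l : I) :
    ∃ f : L2 I, ‖f‖ ≤ ‖T‖ ∧ ∀ n, ‖f n‖ = ‖M n l‖ := by
  classical
  refine ⟨T (lp.single 2 l (1 : ℂ)), ?_, fun n => by rw [represents_iff.1 h n l]⟩
  refine (ContinuousLinearMap.le_opNorm _ _).trans ?_
  rw [lp.norm_single (by norm_num)]
  simp

theorem Bounded2.summable_and_tsum_le {M N : I → I → ℂ} (hM : Bounded2 M) (hN : Bounded2 N)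
    (k l : I) : (Summable fun n => ‖M k n * N n l‖) ∧
      ∑' n, ‖M k n * N n l‖ ≤ opNorm2 M * opNorm2 N := by
  obtain ⟨T, hT, hTn⟩ := hM.exists_represents
  obtain ⟨S, hS, hSn⟩ := hN.exists_represents
  obtain ⟨f, hf, hfk⟩ := hT.exists_row k
  obtain ⟨g, hg, hgl⟩ := hS.exists_col l
  have hr : (2 : ENNReal).toReal.HolderConjugate (2 : ENNReal).toReal := by
    simpa using Real.HolderConjugate.two_two
  obtain ⟨hs, hle⟩ := lp.tsum_mul_le_mul_norm hr f g
  simp only [hfk, hgl, ← norm_mul] at hs hle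
  refine ⟨hs, hle.trans ?_⟩
  rw [← hTn, ← hSn]
  gcongr

/-- Exchanging the roles of the two index sets of a tensor. -/
def swapT (A : Tensor I₁ I₂) : Tensor I₂ I₁ := fun k i j l => A i k l j

variable {A B : Tensor I₁ I₂} {𝒜₁ : SolidBanachAlgebra I₁} {𝒜₂ : SolidBanachAlgebra I₂}

theorem summable_opNorm2_mul (hA : MemT1 𝒜₁.carrier A) (hB : MemT1 𝒜₁.carrier B) (i j : I₁) :
    Summable fun m => opNorm2 (res1 A i m) * opNorm2 (res1 B m j) := by
  have h := ((𝒜₁.bounded _ hA.2).summable_and_tsum_le (𝒜₁.bounded _ hB.2) i j).1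
  simpa [abs_of_nonneg (opNorm2_nonneg _)] using h

theorem MemT1.summable_prod (hA : MemT1 𝒜₁.carrier A) (hB : MemT1 𝒜₁.carrier B)
    (i : I₁) (k l : I₂) (j : I₁) :
    Summable fun mn : I₁ × I₂ => ‖A i k mn.2 mn.1 * B mn.1 mn.2 l j‖ := by
  have h := fun m => (hA.1 i m).summable_and_tsum_le (hB.1 m j) k l
  refine (summable_prod_of_nonneg fun _ => norm_nonneg _).2 ⟨fun m => (h m).1, ?_⟩
  exact (summable_opNorm2_mul hA hB i j).of_nonneg_of_le
    (fun m => tsum_nonneg fun _ => norm_nonneg _) fun m => (h m).2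

theorem MemT1.contractSummable (hA : MemT1 𝒜₁.carrier A) (hB : MemT1 𝒜₁.carrier B) :
    ContractSummable A B :=
  fun i k l j => (hA.summable_prod hB i k l j).prod_symm

theorem contract_eq_tsum_comm (h : ContractSummable A B) (i : I₁) (k l : I₂) (j : I₁) :
    contract A B i k l j = ∑' m, ∑' n, A i k n m * B m n l j :=
  (h i k l j).of_norm.tsum_comm.symm

theorem MemT1.res1_contract (hA : MemT1 𝒜₁.carrier A) (hB : MemT1 𝒜₁.carrier B) (i j : I₁) :
    Bounded2 (res1 (contract A B) i j) ∧ opNorm2 (res1 (contract A B) i j) ≤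
      ∑' m, opNorm2 (res1 A i m) * opNorm2 (res1 B m j) := by
  classical
  choose T hT hTn using fun m => (hA.1 i m).exists_represents
  choose S hS hSn using fun m => (hB.1 m j).exists_represents
  have hle (m : I₁) : ‖(T m).comp (S m)‖ ≤ opNorm2 (res1 A i m) * opNorm2 (res1 B m j) := by
    rw [← hTn, ← hSn]
    exact ContinuousLinearMap.opNorm_comp_le _ _
  have hα := summable_opNorm2_mul hA hB i j
  have hsum : Summable fun m => (T m).comp (S m) := Summable.of_norm_bounded hα hle
  have hrep : Represents (res1 (contract A B) i j) (∑' m, (T m).comp (S m)) := by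
    refine represents_iff.2 fun k l => ?_
    have h := (hsum.hasSum.mapL (ContinuousLinearMap.apply ℂ (L2 I₂)
      (lp.single 2 l (1 : ℂ) : L2 I₂))).mapL (lp.evalCLM ℂ (fun _ : I₂ => ℂ) 2 k)
    refine h.tsum_eq.symm.trans ?_
    rw [res1, contract_eq_tsum_comm (hA.contractSummable hB)]
    refine tsum_congr fun m => ?_
    refine ((hT m (S m (lp.single 2 l (1 : ℂ))) k).tsum_eq.symm).trans (tsum_congr fun n => ?_)
    rw [represents_iff.1 (hS m) n l]
    rfl
  refine ⟨⟨_, hrep⟩, ?_⟩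
  rw [hrep.opNorm2_eq]
  exact tsum_of_norm_bounded hα.hasSum hle

theorem MemT1.contract (hA : MemT1 𝒜₁.carrier A) (hB : MemT1 𝒜₁.carrier B) :
    MemT1 𝒜₁.carrier (contract A B) ∧
      normT1 𝒜₁ (PaperTensor.contract A B) ≤ normT1 𝒜₁ A * normT1 𝒜₁ B := by
  have h := 𝒜₁.solid _ (𝒜₁.mul_mem _ _ hA.2 hB.2)
    (fun i j => (opNorm2 (res1 (PaperTensor.contract A B) i j) : ℂ)) fun i j => by
      have hle := (hA.res1_contract hB i j).2
      simp only [matMul, ← Complex.ofReal_mul, ← Complex.ofReal_tsum, Complex.norm_real,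
        Real.norm_eq_abs]
      rw [abs_of_nonneg (opNorm2_nonneg _)]
      exact hle.trans (le_abs_self _)
  exact ⟨⟨fun i j => (hA.res1_contract hB i j).1, h.1⟩,
    h.2.trans (𝒜₁.anorm_mul _ hA.2 _ hB.2)⟩

theorem swapT_contract (h : ContractSummable A B) :
    contract (swapT A) (swapT B) = swapT (contract A B) := by
  funext k i j l
  exact (contract_eq_tsum_comm h i k l j).symm

theorem MemT2.contract (hA : MemT2 𝒜₂.carrier A) (hB : MemT2 𝒜₂.carrier B)
    (h : ContractSummable A B) :
    MemT2 𝒜₂.carrier (contract A B) ∧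
      normT2 𝒜₂ (PaperTensor.contract A B) ≤ normT2 𝒜₂ A * normT2 𝒜₂ B := by
  have hA' : MemT1 𝒜₂.carrier (swapT A) := hA
  have hB' : MemT1 𝒜₂.carrier (swapT B) := hB
  have hAB := hA'.contract hB'
  rw [swapT_contract h] at hAB
  exact hAB

/-- the doubly contracted product of two elements of `𝒜` is well defined, lies in
`𝒜`, and the norm is submultiplicative. -/
theorem statement6 {I₁ I₂ : Type*} [Countable I₁] [Countable I₂]
    (𝒜₁ : SolidBanachAlgebra I₁) (𝒜₂ : SolidBanachAlgebra I₂)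
    (A B : Tensor I₁ I₂) (hA : MemA 𝒜₁ 𝒜₂ A) (hB : MemA 𝒜₁ 𝒜₂ B) :
    ContractSummable A B ∧ MemA 𝒜₁ 𝒜₂ (contract A B) ∧
      normA 𝒜₁ 𝒜₂ (contract A B) ≤ normA 𝒜₁ 𝒜₂ A * normA 𝒜₁ 𝒜₂ B := by
  have hs := hA.1.contractSummable hB.1
  obtain ⟨h₁, hn₁⟩ := hA.1.contract hB.1
  obtain ⟨h₂, hn₂⟩ := hA.2.contract hB.2 hs
  have hA₁ : 0 ≤ normT1 𝒜₁ A := 𝒜₁.anorm_nonneg _ hA.1.2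
  have hB₁ : 0 ≤ normT1 𝒜₁ B := 𝒜₁.anorm_nonneg _ hB.1.2
  have hB₂ : 0 ≤ normT2 𝒜₂ B := 𝒜₂.anorm_nonneg _ hB.2.2
  have hAn : 0 ≤ normA 𝒜₁ 𝒜₂ A := hA₁.trans (le_max_left _ _)
  exact ⟨hs, ⟨h₁, h₂⟩, max_le
    (hn₁.trans (mul_le_mul (le_max_left _ _) (le_max_left _ _) hB₁ hAn))
    (hn₂.trans (mul_le_mul (le_max_right _ _) (le_max_right _ _) hB₂ hAn))⟩

end PaperTensor
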